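/- (Minimax equality.) If (w̄,σ̄) is a stationary point of Ξ with σ̄ ∈ S⁺, then inf_{w ∈ ℝⁿ} sup_{σ ∈ ℝᵖ} Ξ(w,σ) = sup_{σ ∈ S⁺} inf_{w ∈ ℝⁿ} Ξ(w,σ) = Ξ(w̄,σ̄); that is, min-max equals max-min over ℝⁿ × S⁺ and both are attained at the stationary point. -/

import Mathlib

open Matrix

/-- `G σ = A + Σ σ_i B_i`. -/
noncomputable def G {n p : ℕ} (A : Matrix (Fin n) (Fin n) ℝ)
    (B : Fin p → Matrix (Fin n) (Fin n) ℝ) (σ : Fin p → ℝ) : Matrix (Fin n) (Fin n) ℝ :=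
  A + ∑ i, σ i • B i

/-- The total complementary energy
`Ξ(w,σ) = (1/2) wᵀ G(σ) w − (1/2) σᵀ K σ − ℓᵀ σ − fᵀ w − c`. -/
noncomputable def Xi {n p : ℕ} (A : Matrix (Fin n) (Fin n) ℝ)
    (B : Fin p → Matrix (Fin n) (Fin n) ℝ) (K : Matrix (Fin p) (Fin p) ℝ)
    (f : Fin n → ℝ) (ℓ : Fin p → ℝ) (c : ℝ) (w : Fin n → ℝ) (σ : Fin p → ℝ) : ℝ :=
  (1/2) * (w ⬝ᵥ (G A B σ).mulVec w) - (1/2) * (σ ⬝ᵥ K.mulVec σ) - ℓ ⬝ᵥ σ - f ⬝ᵥ w - c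

/-- `h(w)_i = (1/2) wᵀ B_i w`. -/
noncomputable def hq {n p : ℕ} (B : Fin p → Matrix (Fin n) (Fin n) ℝ)
    (w : Fin n → ℝ) : Fin p → ℝ :=
  fun i => (1/2) * (w ⬝ᵥ (B i).mulVec w)

/-- A quadratic function with symmetric matrix, expanded around a critical point. -/
theorem half_quadratic_sub_linear_eq {ι : Type*} [Fintype ι] {M : Matrix ι ι ℝ}
    (hM : M.IsSymm) {b x₀ : ι → ℝ} (h : M *ᵥ x₀ = b) (x : ι → ℝ) :
    (1/2) * (x ⬝ᵥ M *ᵥ x) - b ⬝ᵥ x =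
      (1/2) * (x₀ ⬝ᵥ M *ᵥ x₀) - b ⬝ᵥ x₀ + (1/2) * ((x - x₀) ⬝ᵥ M *ᵥ (x - x₀)) := by
  have hsymm : x₀ ⬝ᵥ M *ᵥ x = b ⬝ᵥ x := by
    rw [dotProduct_mulVec, ← mulVec_transpose, hM.eq, h]
  rw [mulVec_sub, dotProduct_sub, sub_dotProduct, sub_dotProduct, hsymm, h,
    dotProduct_comm x b, dotProduct_comm x₀ b]
  ring

/-- A quadratic function with positive definite matrix is minimized at its critical point. -/
theorem Matrix.PosDef.half_quadratic_sub_linear_le {ι : Type*} [Fintype ι] {M : Matrix ι ι ℝ}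
    (hM : M.PosDef) {b x₀ : ι → ℝ} (h : M *ᵥ x₀ = b) (x : ι → ℝ) :
    (1/2) * (x₀ ⬝ᵥ M *ᵥ x₀) - b ⬝ᵥ x₀ ≤ (1/2) * (x ⬝ᵥ M *ᵥ x) - b ⬝ᵥ x := by
  have hsymm : M.IsSymm := by
    simpa [Matrix.IsHermitian, Matrix.IsSymm, conjTranspose_eq_transpose_of_trivial]
      using hM.isHermitian
  have hnonneg : 0 ≤ (x - x₀) ⬝ᵥ M *ᵥ (x - x₀) := by
    simpa using hM.posSemidef.dotProduct_mulVec_nonneg (x - x₀)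
  rw [half_quadratic_sub_linear_eq hsymm h x]
  linarith

theorem Matrix.PosDef.exists_mulVec_eq {ι : Type*} [Fintype ι] {M : Matrix ι ι ℝ}
    (hM : M.PosDef) (b : ι → ℝ) : ∃ x, M *ᵥ x = b := by
  classical
  refine ⟨M⁻¹ *ᵥ b, ?_⟩
  rw [mulVec_mulVec, mul_nonsing_inv _ hM.det_pos.ne'.isUnit, one_mulVec]

section Energy

variable {n p : ℕ} {A : Matrix (Fin n) (Fin n) ℝ} {B : Fin p → Matrix (Fin n) (Fin n) ℝ}
  {K : Matrix (Fin p) (Fin p) ℝ} {f : Fin n → ℝ} {ℓ : Fin p → ℝ} {c : ℝ}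

theorem half_dotProduct_G_mulVec (w : Fin n → ℝ) (σ : Fin p → ℝ) :
    (1/2) * (w ⬝ᵥ G A B σ *ᵥ w) = (1/2) * (w ⬝ᵥ A *ᵥ w) + hq B w ⬝ᵥ σ := by
  have hsum : (∑ i, σ i • B i) *ᵥ w = ∑ i, σ i • (B i *ᵥ w) := by
    rw [sum_mulVec]
    simp only [smul_mulVec]
  rw [G, add_mulVec, dotProduct_add, hsum, dotProduct_sum, mul_add, Finset.mul_sum]
  congr 1
  refine Finset.sum_congr rfl fun i _ => ?_
  rw [dotProduct_smul, hq, smul_eq_mul]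
  ring

theorem Xi_le_of_mulVec_eq_hq_sub (hK : K.PosDef) {w : Fin n → ℝ} {σ₀ : Fin p → ℝ}
    (h : K *ᵥ σ₀ = hq B w - ℓ) (σ : Fin p → ℝ) :
    Xi A B K f ℓ c w σ ≤ Xi A B K f ℓ c w σ₀ := by
  have hle := hK.half_quadratic_sub_linear_le h σ
  simp only [sub_dotProduct] at hle
  simp only [Xi, half_dotProduct_G_mulVec]
  linarith

theorem Xi_le_of_G_mulVec_eq {σ : Fin p → ℝ} (hG : (G A B σ).PosDef) {w₀ : Fin n → ℝ}
    (h : G A B σ *ᵥ w₀ = f) (w : Fin n → ℝ) :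
    Xi A B K f ℓ c w₀ σ ≤ Xi A B K f ℓ c w σ := by
  have hle := hG.half_quadratic_sub_linear_le h w
  simp only [Xi]
  linarith

theorem bddAbove_range_Xi (hK : K.PosDef) (w : Fin n → ℝ) :
    BddAbove (Set.range fun σ => Xi A B K f ℓ c w σ) := by
  obtain ⟨σ₀, h⟩ := hK.exists_mulVec_eq (hq B w - ℓ)
  exact ⟨_, Set.forall_mem_range.2 (Xi_le_of_mulVec_eq_hq_sub hK h)⟩

theorem bddBelow_range_Xi {σ : Fin p → ℝ} (hG : (G A B σ).PosDef) :
    BddBelow (Set.range fun w => Xi A B K f ℓ c w σ) := by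
  obtain ⟨w₀, h⟩ := hG.exists_mulVec_eq f
  exact ⟨_, Set.forall_mem_range.2 (Xi_le_of_G_mulVec_eq hG h)⟩

end Energy

/-- Minimax equality: if `(w̄,σ̄)` is a stationary point of `Ξ` with `G(σ̄)`
positive definite, then
`inf_w sup_σ Ξ(w,σ) = sup_{σ ∈ S⁺} inf_w Ξ(w,σ) = Ξ(w̄,σ̄)`. -/
theorem stmt_14 (n p : ℕ) (hn : 0 < n) (hp : 0 < p)
    (A : Matrix (Fin n) (Fin n) ℝ) (hA : A.IsSymm)
    (B : Fin p → Matrix (Fin n) (Fin n) ℝ) (hB : ∀ i, (B i).IsSymm)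
    (K : Matrix (Fin p) (Fin p) ℝ) (hK : K.PosDef)
    (f : Fin n → ℝ) (ℓ : Fin p → ℝ) (c : ℝ)
    (wbar : Fin n → ℝ) (σbar : Fin p → ℝ)
    (hstat1 : (G A B σbar).mulVec wbar = f)
    (hstat2 : hq B wbar - K.mulVec σbar - ℓ = 0)
    (hGpd : (G A B σbar).PosDef) :
    (⨅ w : Fin n → ℝ, ⨆ σ : Fin p → ℝ, Xi A B K f ℓ c w σ) =
        Xi A B K f ℓ c wbar σbar ∧
      (⨆ σ : {s : Fin p → ℝ // (G A B s).PosDef}, ⨅ w : Fin n → ℝ,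
          Xi A B K f ℓ c w σ.1) = Xi A B K f ℓ c wbar σbar := by
  have hσ : K *ᵥ σbar = hq B wbar - ℓ := by
    rw [sub_right_comm, sub_eq_zero] at hstat2
    exact hstat2.symm
  have hmax : ∀ σ, Xi A B K f ℓ c wbar σ ≤ Xi A B K f ℓ c wbar σbar :=
    Xi_le_of_mulVec_eq_hq_sub hK hσ
  have hmin : ∀ w, Xi A B K f ℓ c wbar σbar ≤ Xi A B K f ℓ c w σbar :=
    Xi_le_of_G_mulVec_eq hGpd hstat1
  have hsup : ∀ w, Xi A B K f ℓ c wbar σbar ≤ ⨆ σ, Xi A B K f ℓ c w σ := fun w =>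
    (hmin w).trans (le_ciSup (bddAbove_range_Xi hK w) σbar)
  have hinf : ∀ σ : {s : Fin p → ℝ // (G A B s).PosDef},
      ⨅ w, Xi A B K f ℓ c w σ.1 ≤ Xi A B K f ℓ c wbar σbar := fun σ =>
    (ciInf_le (bddBelow_range_Xi σ.2) wbar).trans (hmax σ.1)
  have : Nonempty {s : Fin p → ℝ // (G A B s).PosDef} := ⟨⟨σbar, hGpd⟩⟩
  constructor
  · exact le_antisymm
      ((ciInf_le ⟨_, Set.forall_mem_range.2 hsup⟩ wbar).trans (ciSup_le hmax))
      (le_ciInf hsup)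
  · exact le_antisymm (ciSup_le hinf)
      ((le_ciInf hmin).trans
        (le_ciSup (f := fun σ : {s : Fin p → ℝ // (G A B s).PosDef} =>
          ⨅ w, Xi A B K f ℓ c w σ.1) ⟨_, Set.forall_mem_range.2 hinf⟩ ⟨σbar, hGpd⟩))
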